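/- Let A and B be pretriangulated categories (triangulated categories with shift functor [1]) and let Φ : A → B be an exact functor (commuting with shifts up to natural isomorphism and sending distinguished triangles to distinguished triangles) which is fully faithful and admits a left adjoint Ψ' : B → A. For any object b of B, complete the unit morphism η_b : b → Φ(Ψ'(b)) to a distinguished triangle c → b → Φ(Ψ'(b)) → c[1]. Then Hom(c, Φ(a)[p]) = 0 for every object a of A and every integer p. In particular every object b of B sits in a distinguished triangle c → b → b'' → c[1] with b'' in the essential image of Φ and c in the left orthogonal complement C' = { c ∈ B : Hom(c, Φ(a)) = 0 for all a ∈ A }, so that B = ⟨Φ(A), C'⟩ is a semiorthogonal decomposition. -/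

import Mathlib

open CategoryTheory CategoryTheory.Pretriangulated CategoryTheory.Limits

namespace CategoryTheory.Adjunction

variable {A B : Type*} [Category A] [Category B] {Φ : A ⥤ B} {Ψ : B ⥤ A} (adj : Ψ ⊣ Φ)

lemma exists_unit_comp_eq {b : B} {a : A} (g : b ⟶ Φ.obj a) :
    ∃ k : Φ.obj (Ψ.obj b) ⟶ Φ.obj a, adj.unit.app b ≫ k = g :=
  ⟨Φ.map ((adj.homEquiv b a).symm g),
    (adj.homEquiv_unit ..).symm.trans ((adj.homEquiv b a).apply_symm_apply g)⟩

lemma eq_zero_of_unit_comp_eq_zero [Preadditive B] [Φ.Full] {b x : B} {a : A}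
    (e : x ≅ Φ.obj a) (k : Φ.obj (Ψ.obj b) ⟶ x) (hk : adj.unit.app b ≫ k = 0) : k = 0 := by
  have map_eq_zero (m : Φ.obj (Ψ.obj b) ⟶ Φ.obj a) (hm : adj.unit.app b ≫ m = 0) : m = 0 := by
    obtain ⟨u, rfl⟩ := Φ.map_surjective m
    obtain ⟨v, hv⟩ := Φ.map_surjective (0 : Φ.obj (Ψ.obj b) ⟶ Φ.obj a)
    have huv : u = v := (adj.homEquiv b a).injective (by
      rw [adj.homEquiv_unit, adj.homEquiv_unit, hm, hv, comp_zero])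
    rw [huv, hv]
  rw [← cancel_mono e.hom, zero_comp]
  exact map_eq_zero _ (by rw [← Category.assoc, hk, zero_comp])

end CategoryTheory.Adjunction

/-- Dual Bondal–Van den Bergh: let `Φ : A ⥤ B` be a fully faithful exact functor
between pretriangulated categories admitting a left adjoint `Ψ'`.  For any object `b`
of `B`, if `c → b → Φ(Ψ'(b)) → c[1]` is a distinguished triangle whose second map is
the unit, then `Hom(c, Φ(a)[p]) = 0` for every object `a` of `A` and every integer
`p`; hence `c` lies in the left orthogonal complement of the image of `Φ` and
`B = ⟨Φ(A), C'⟩` is a semiorthogonal decomposition. -/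
theorem sod_of_fullyFaithful_leftAdjoint
    (A : Type*) [Category A] [HasZeroObject A] [Preadditive A] [HasShift A ℤ]
    [∀ n : ℤ, (shiftFunctor A n).Additive] [Pretriangulated A]
    (B : Type*) [Category B] [HasZeroObject B] [Preadditive B] [HasShift B ℤ]
    [∀ n : ℤ, (shiftFunctor B n).Additive] [Pretriangulated B]
    (Φ : A ⥤ B) [Φ.CommShift ℤ] [Φ.IsTriangulated]
    (hfull : Φ.Full) (hfaithful : Φ.Faithful)
    (Ψ' : B ⥤ A) (adj : Ψ' ⊣ Φ)
    (b c : B) (f : c ⟶ b) (h : Φ.obj (Ψ'.obj b) ⟶ c⟦(1 : ℤ)⟧)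
    (hT : Triangle.mk f (adj.unit.app b) h ∈ distTriang B) :
    ∀ (a : A) (p : ℤ) (φ : c ⟶ (Φ.obj a)⟦p⟧), φ = 0 := by
  intro a p φ
  let e : (Φ.obj a)⟦p⟧ ≅ Φ.obj (a⟦p⟧) := ((Φ.commShiftIso p).app a).symm
  let e' : ((Φ.obj a)⟦p⟧)⟦(1 : ℤ)⟧ ≅ Φ.obj ((a⟦p⟧)⟦(1 : ℤ)⟧) :=
    (shiftFunctor B (1 : ℤ)).mapIso e ≪≫ ((Φ.commShiftIso (1 : ℤ)).app (a⟦p⟧)).symm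
  have hηh : adj.unit.app b ≫ h = 0 := comp_distTriang_mor_zero₂₃ _ hT
  have hfη : f ≫ adj.unit.app b = 0 := comp_distTriang_mor_zero₁₂ _ hT
  have hφ : h ≫ φ⟦(1 : ℤ)⟧' = 0 :=
    adj.eq_zero_of_unit_comp_eq_zero e' _ (by rw [← Category.assoc, hηh, zero_comp])
  obtain ⟨g, hg⟩ : ∃ g : b⟦(1 : ℤ)⟧ ⟶ ((Φ.obj a)⟦p⟧)⟦(1 : ℤ)⟧, φ⟦(1 : ℤ)⟧' = (-f⟦(1 : ℤ)⟧') ≫ g :=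
    Triangle.yoneda_exact₃ _ (rot_of_distTriang _ hT) (φ⟦(1 : ℤ)⟧') hφ
  obtain ⟨g', rfl⟩ := (shiftFunctor B (1 : ℤ)).map_surjective g
  have hfg : φ = (-f) ≫ g' := (shiftFunctor B (1 : ℤ)).map_injective (by
    rw [hg, Functor.map_comp, Functor.map_neg])
  obtain ⟨k, hk⟩ := adj.exists_unit_comp_eq (g' ≫ e.hom)
  rw [← cancel_mono e.hom, hfg, Category.assoc, ← hk, Preadditive.neg_comp, ← Category.assoc, hfη,
    zero_comp, zero_comp, neg_zero]
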